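/- Bekič's bisection lemma for greatest fixed points: let X and Y be complete lattices and let f : X × Y → X and g : X × Y → Y be monotone maps. Then the greatest fixed point of the monotone map (x, y) ↦ (f(x,y), g(x,y)) on X × Y equals (x₀, y₀), where x₀ = ν x. f(x, ν y. g(x, y)) and y₀ = ν y. g(x₀, y), with ν denoting greatest fixed points of monotone maps (which exist by the Knaster–Tarski theorem). -/

import Mathlib

/-- **Coinduction**: every post-fixed point of a monotone map on a complete lattice lies below
its greatest fixed point. -/
theorem Monotone.le_of_isGreatest_fixedPoints {α : Type*} [CompleteLattice α] {h : α → α}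
    (hh : Monotone h) {a b : α} (ha : IsGreatest {x | h x = x} a) (hb : b ≤ h b) : b ≤ a :=
  (OrderHom.le_gfp ⟨h, hh⟩ hb).trans (ha.2 (OrderHom.map_gfp ⟨h, hh⟩))

/-- Bekič's bisection lemma for greatest fixed points: let `X`, `Y` be complete
lattices and `f : X × Y → X`, `g : X × Y → Y` monotone. Let `k x = ν y. g (x, y)`
(i.e., `k x` is the greatest fixed point of `y ↦ g (x, y)`, for each `x`), let
`x₀ = ν x. f (x, k x)` and `y₀ = ν y. g (x₀, y)`. Then `(x₀, y₀)` is the greatest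
fixed point of the map `(x, y) ↦ (f (x, y), g (x, y))` on `X × Y`. -/
theorem bekic_gfp {X Y : Type*} [CompleteLattice X] [CompleteLattice Y]
    (f : X × Y → X) (g : X × Y → Y) (hf : Monotone f) (hg : Monotone g)
    (k : X → Y) (hk : ∀ x, IsGreatest {y | g (x, y) = y} (k x))
    (x₀ : X) (hx₀ : IsGreatest {x | f (x, k x) = x} x₀)
    (y₀ : Y) (hy₀ : IsGreatest {y | g (x₀, y) = y} y₀) :
    IsGreatest {p : X × Y | (f p, g p) = p} (x₀, y₀) := by
  have hg' (x : X) : Monotone fun y => g (x, y) :=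
    fun _ _ h => hg (Prod.mk_le_mk.2 ⟨le_rfl, h⟩)
  have hk_mono : Monotone k := fun x x' h =>
    (hg' x').le_of_isGreatest_fixedPoints (hk x')
      ((hk x).1.ge.trans (hg (Prod.mk_le_mk.2 ⟨h, le_rfl⟩)))
  have hfk : Monotone fun x => f (x, k x) :=
    fun _ _ h => hf (Prod.mk_le_mk.2 ⟨h, hk_mono h⟩)
  obtain rfl : k x₀ = y₀ := (hk x₀).unique hy₀
  refine ⟨Prod.ext hx₀.1 hy₀.1, ?_⟩
  rintro ⟨x, y⟩ hp
  obtain ⟨hx, hy⟩ := Prod.mk.inj hp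
  have hxx₀ : x ≤ x₀ := hfk.le_of_isGreatest_fixedPoints hx₀
    (hx.ge.trans (hf (Prod.mk_le_mk.2 ⟨le_rfl, (hk x).2 hy⟩)))
  exact Prod.mk_le_mk.2 ⟨hxx₀, ((hk x).2 hy).trans (hk_mono hxx₀)⟩
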